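/- Fix k ≥ 1 and 0 < ε < 1, let ω : ℕ → ℝ be any function tending to infinity, and let p : ℕ → [0,1] satisfy p(n) ≥ ((k+2)(k+1)·log n + ω(n))/(ε²(n−k−1)) for all n > k+1. Let V be a random subcomplex of the n-dimensional cross-polytope containing its full k-skeleton in which each (k+1)-face is included independently with probability p(n). Then asymptotically almost surely h^k(V) ≥ 2(1−ε)(n−k−1)p(n)/(k+2); that is, the probability that every k-cochain β on the cross-polytope that is not a coboundary satisfies ‖dβ‖_V ≥ (2(1−ε)(n−k−1)p(n)/(k+2))·‖[β]‖ tends to 1 as n → ∞. -/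

import Mathlib

open scoped Classical

/-- A face of the `n`-dimensional cross-polytope, indexed by the number of its
vertices: an element of `XFace n m` is a pair `(S, s)` of an `m`-element
subset `S ⊆ {1, …, n}` together with a sign `s : S → {+1, -1}`, encoded as a
function `f : Fin n → Option Bool` with exactly `m` coordinates not equal to
`none` (`some true` = `+1`, `some false` = `-1`).  Thus `XFace n (k+1)` is the
set of `k`-dimensional faces. -/
abbrev XFace (n m : ℕ) : Type :=
  {f : Fin n → Option Bool // (Finset.univ.filter fun i => f i ≠ none).card = m}

/-- The norm of a `ZMod 2`-cochain: the size of its support. -/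
def cnorm {X : Type} [Fintype X] (β : X → ZMod 2) : ℕ :=
  (Finset.univ.filter fun x => β x ≠ 0).card

/-- The coboundary map of the cross-polytope: for a cochain `β` on faces with
`m` vertices, `xd β` evaluated on a face `g` with `m+1` vertices is the sum of
`β f` over the `m+1` faces `f` obtained from `g` by deleting one vertex. -/
def xd {n m : ℕ} (β : XFace n m → ZMod 2) : XFace n (m + 1) → ZMod 2 :=
  fun g => ∑ f : XFace n m,
    if ∃ i, g.1 i ≠ none ∧ f.1 = Function.update g.1 i none then β f else 0

/-- A `k`-cochain (on faces with `k+1` vertices) is a coboundary if it is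
`dα` for some `(k-1)`-cochain `α`. -/
def IsXCob {n k : ℕ} (β : XFace n (k + 1) → ZMod 2) : Prop :=
  ∃ α : XFace n k → ZMod 2, xd α = β

/-- The quotient norm `‖[β]‖ = min_α ‖β + dα‖` of a `k`-cochain on the
cross-polytope. -/
noncomputable def xqnorm {n k : ℕ} (β : XFace n (k + 1) → ZMod 2) : ℕ :=
  sInf {m | ∃ α : XFace n k → ZMod 2, m = cnorm (β + xd α)}

/-- The set of coordinates used by a face, for faces given as ungraded sign vectors. -/
def faceSupp {n : ℕ} (f : Fin n → Option Bool) : Finset (Fin n) :=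
  Finset.univ.filter fun i => f i ≠ none

/-- The faces with `m` vertices whose coordinates all lie in `A`. -/
def facesIn {n : ℕ} (A : Finset (Fin n)) (m : ℕ) : Finset (Fin n → Option Bool) :=
  Finset.univ.filter fun f => faceSupp f ⊆ A ∧ (faceSupp f).card = m

/-- The coboundary map on ungraded cochains. -/
def cobd {n : ℕ} (F : (Fin n → Option Bool) → ZMod 2) (g : Fin n → Option Bool) : ZMod 2 :=
  ∑ i ∈ faceSupp g, F (Function.update g i none)

section Faces

variable {n : ℕ}

theorem mem_faceSupp {f : Fin n → Option Bool} {i : Fin n} : i ∈ faceSupp f ↔ f i ≠ none := by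
  simp [faceSupp]

theorem mem_facesIn {A : Finset (Fin n)} {m : ℕ} {f : Fin n → Option Bool} :
    f ∈ facesIn A m ↔ faceSupp f ⊆ A ∧ (faceSupp f).card = m := by
  simp [facesIn]

theorem faceSupp_update_some (f : Fin n → Option Bool) (i : Fin n) (s : Bool) :
    faceSupp (Function.update f i (some s)) = insert i (faceSupp f) := by
  ext j
  by_cases h : j = i
  · subst h; simp [mem_faceSupp]
  · simp [mem_faceSupp, h]

theorem faceSupp_update_none (f : Fin n → Option Bool) (i : Fin n) :
    faceSupp (Function.update f i none) = (faceSupp f).erase i := by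
  ext j
  by_cases h : j = i
  · subst h; simp [mem_faceSupp]
  · simp [mem_faceSupp, h]

theorem cobd_of_ne_none (F : (Fin n → Option Bool) → ZMod 2) {f : Fin n → Option Bool}
    {i : Fin n} (h : f i ≠ none) :
    cobd F f = F (Function.update f i none) +
      ∑ j ∈ faceSupp (Function.update f i none), F (Function.update f j none) := by
  rw [cobd, faceSupp_update_none]
  exact (Finset.add_sum_erase _ (fun j => F (Function.update f j none)) (mem_faceSupp.2 h)).symm

theorem cobd_update_some (F : (Fin n → Option Bool) → ZMod 2) {f : Fin n → Option Bool}
    {i : Fin n} (h : f i = none) (s : Bool) :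
    cobd F (Function.update f i (some s)) = F f +
      ∑ j ∈ faceSupp f, F (Function.update (Function.update f j none) i (some s)) := by
  have hf : Function.update f i none = f := by rw [← h, Function.update_eq_self]
  rw [cobd_of_ne_none F (i := i) (by simp), Function.update_idem, hf]
  congr 1
  refine Finset.sum_congr rfl fun j hj => ?_
  have hij : i ≠ j := by rintro rfl; exact mem_faceSupp.1 hj h
  rw [Function.update_comm hij]

/-- The difference of the two links of `β` at the vertices over coordinate `i`. -/
def linkDiff (β : (Fin n → Option Bool) → ZMod 2) (i : Fin n) (g : Fin n → Option Bool) :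
    ZMod 2 :=
  β (Function.update g i (some true)) + β (Function.update g i (some false))

theorem linkDiff_eq (β : (Fin n → Option Bool) → ZMod 2) (i : Fin n) (g : Fin n → Option Bool)
    (s : Bool) : linkDiff β i g =
      β (Function.update g i (some s)) + β (Function.update g i (some !s)) := by
  cases s
  · exact add_comm _ _
  · rfl

theorem cobd_linkDiff (β : (Fin n → Option Bool) → ZMod 2) {i : Fin n}
    {g : Fin n → Option Bool} (h : g i = none) :
    cobd (linkDiff β i) g = cobd β (Function.update g i (some true)) +
      cobd β (Function.update g i (some false)) := by
  rw [cobd_update_some β h, cobd_update_some β h, add_add_add_comm, CharTwo.add_self_eq_zero,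
    zero_add, ← Finset.sum_add_distrib]
  rfl

/-- Cone `β` off at the vertex `(i, s)`, using `γ` on the faces through the antipodal vertex. -/
def coneCochain (β γ : (Fin n → Option Bool) → ZMod 2) (i : Fin n) (s : Bool)
    (f : Fin n → Option Bool) : ZMod 2 :=
  if f i = none then β (Function.update f i (some s))
  else if f i = some s then 0 else γ (Function.update f i none)

theorem add_cobd_coneCochain_of_none (β γ : (Fin n → Option Bool) → ZMod 2) {i : Fin n}
    (s : Bool) {f : Fin n → Option Bool} (h : f i = none) :
    β f + cobd (coneCochain β γ i s) f = cobd β (Function.update f i (some s)) := by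
  rw [cobd_update_some β h]
  congr 1
  refine Finset.sum_congr rfl fun j hj => ?_
  have hij : i ≠ j := by rintro rfl; exact mem_faceSupp.1 hj h
  rw [coneCochain, if_pos (by simp [hij, h])]

theorem add_cobd_coneCochain_of_some (β γ : (Fin n → Option Bool) → ZMod 2) {i : Fin n}
    {s : Bool} {f : Fin n → Option Bool} (h : f i = some s) :
    β f + cobd (coneCochain β γ i s) f = 0 := by
  have hf : Function.update f i (some s) = f := by rw [← h, Function.update_eq_self]
  rw [cobd_of_ne_none _ (i := i) (by simp [h]), Finset.sum_eq_zero, add_zero, coneCochain,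
    if_pos (by simp), Function.update_idem, hf, CharTwo.add_self_eq_zero]
  intro j hj
  have hij : i ≠ j := by rintro rfl; simp [faceSupp_update_none] at hj
  simp [coneCochain, hij, h]

theorem add_cobd_coneCochain_of_not (β γ : (Fin n → Option Bool) → ZMod 2) {i : Fin n}
    {s : Bool} {f : Fin n → Option Bool} (h : f i = some !s) :
    β f + cobd (coneCochain β γ i s) f = linkDiff β i (Function.update f i none) +
      cobd γ (Function.update f i none) := by
  have hf : Function.update f i (some !s) = f := by rw [← h, Function.update_eq_self]
  rw [cobd_of_ne_none _ (i := i) (by simp [h]), linkDiff_eq β i _ s, Function.update_idem,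
    Function.update_idem, hf, coneCochain, if_pos (by simp), Function.update_idem, ← add_assoc,
    add_comm (β f)]
  congr 1
  refine Finset.sum_congr rfl fun j hj => ?_
  have hij : i ≠ j := by rintro rfl; simp [faceSupp_update_none] at hj
  rw [coneCochain, if_neg (by simp [hij, h]), if_neg (by simp [hij, h]),
    Function.update_comm hij]

theorem card_support_add_cobd_coneCochain_le (β γ : (Fin n → Option Bool) → ZMod 2)
    (A : Finset (Fin n)) (k : ℕ) (i : Fin n) (s : Bool) :
    ((facesIn A (k + 1)).filter fun f => β f + cobd (coneCochain β γ i s) f ≠ 0).card ≤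
      ((facesIn (A.erase i) (k + 1)).filter
        fun f => cobd β (Function.update f i (some s)) ≠ 0).card +
      ((facesIn (A.erase i) k).filter fun g => linkDiff β i g + cobd γ g ≠ 0).card := by
  refine le_trans (Finset.card_le_card (t := _ ∪ Finset.image
    (fun g => Function.update g i (some !s)) _) ?_)
    ((Finset.card_union_le _ _).trans (Nat.add_le_add_left Finset.card_image_le _))
  intro f hf
  obtain ⟨hf, h0⟩ := Finset.mem_filter.1 hf
  obtain ⟨hA, hc⟩ := mem_facesIn.1 hf
  rw [Finset.mem_union]
  by_cases h : f i = none
  · left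
    rw [add_cobd_coneCochain_of_none β γ s h] at h0
    refine Finset.mem_filter.2 ⟨mem_facesIn.2 ⟨?_, hc⟩, h0⟩
    exact Finset.subset_erase.2 ⟨hA, fun hi => mem_faceSupp.1 hi h⟩
  · right
    have hs : f i = some !s := by
      by_cases h' : f i = some s
      · exact absurd (add_cobd_coneCochain_of_some β γ h') h0
      · revert h h'
        rcases f i with _ | _ | _ <;> cases s <;> simp
    rw [add_cobd_coneCochain_of_not β γ hs] at h0
    refine Finset.mem_image.2 ⟨Function.update f i none, Finset.mem_filter.2 ⟨?_, h0⟩, ?_⟩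
    · rw [mem_facesIn, faceSupp_update_none, Finset.card_erase_of_mem (mem_faceSupp.2 h), hc]
      exact ⟨Finset.erase_subset_erase _ hA, rfl⟩
    · rw [Function.update_idem, ← hs, Function.update_eq_self]

theorem card_cobd_linkDiff_le (β : (Fin n → Option Bool) → ZMod 2) (A : Finset (Fin n)) (m : ℕ)
    (i : Fin n) :
    ((facesIn (A.erase i) m).filter fun g => cobd (linkDiff β i) g ≠ 0).card ≤
      ∑ s : Bool, ((facesIn (A.erase i) m).filter
        fun f => cobd β (Function.update f i (some s)) ≠ 0).card := by
  rw [Fintype.sum_bool]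
  refine le_trans (Finset.card_le_card ?_) (Finset.card_union_le _ _)
  intro g hg
  obtain ⟨hg, h0⟩ := Finset.mem_filter.1 hg
  have hi : g i = none := by
    by_contra h
    simpa using (mem_facesIn.1 hg).1 (mem_faceSupp.2 h)
  rw [cobd_linkDiff β hi] at h0
  by_contra h
  simp only [Finset.mem_union, Finset.mem_filter, hg, true_and, not_or, not_not] at h
  simp [h.1, h.2] at h0

theorem sum_card_cobd_update_le (β : (Fin n → Option Bool) → ZMod 2) (A : Finset (Fin n))
    (m : ℕ) :
    ∑ i ∈ A, ∑ s : Bool, ((facesIn (A.erase i) m).filter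
        fun f => cobd β (Function.update f i (some s)) ≠ 0).card ≤
      (m + 1) * ((facesIn A (m + 1)).filter fun g => cobd β g ≠ 0).card := by
  set Z := (facesIn A (m + 1)).filter fun g => cobd β g ≠ 0 with hZ
  calc _ ≤ ∑ i ∈ A, ∑ s : Bool, (Z.filter fun g => g i = some s).card := by
        refine Finset.sum_le_sum fun i hi => Finset.sum_le_sum fun s _ => ?_
        have hnone : ∀ f ∈ facesIn (A.erase i) m, f i = none := by
          intro f hf
          by_contra h
          simpa using (mem_facesIn.1 hf).1 (mem_faceSupp.2 h)
        refine Finset.card_le_card_of_injOn (fun f => Function.update f i (some s)) ?_ ?_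
        · intro f hf
          obtain ⟨hf, h0⟩ := Finset.mem_filter.1 hf
          obtain ⟨hA, hc⟩ := mem_facesIn.1 hf
          refine Finset.mem_filter.2 ⟨Finset.mem_filter.2 ⟨mem_facesIn.2 ?_, h0⟩, by simp⟩
          rw [faceSupp_update_some, Finset.card_insert_of_notMem, hc]
          · exact ⟨Finset.insert_subset hi (hA.trans (Finset.erase_subset _ _)), rfl⟩
          · exact fun h => mem_faceSupp.1 h (hnone f hf)
        · intro f hf g hg hfg
          have hf := hnone f (Finset.mem_filter.1 hf).1
          have hg := hnone g (Finset.mem_filter.1 hg).1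
          have := congrArg (fun x => Function.update x i none) hfg
          simp only [Function.update_idem] at this
          rwa [← hf, Function.update_eq_self, hf, ← hg, Function.update_eq_self] at this
    _ = ∑ i ∈ A, (Z.filter fun g => g i ≠ none).card := by
        refine Finset.sum_congr rfl fun i _ => ?_
        rw [Fintype.sum_bool, ← Finset.card_union_of_disjoint, ← Finset.filter_or]
        · congr 1
          refine Finset.filter_congr fun g _ => ?_
          rcases g i with _ | _ | _ <;> simp
        · rw [Finset.disjoint_filter]
          intro g _ h
          simp [h]
    _ = ∑ g ∈ Z, (A.filter fun i => g i ≠ none).card :=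
        Finset.sum_card_bipartiteAbove_eq_sum_card_bipartiteBelow
          (fun (i : Fin n) (g : Fin n → Option Bool) => g i ≠ none)
    _ ≤ ∑ _g ∈ Z, (m + 1) := by
        refine Finset.sum_le_sum fun g hg => ?_
        rw [← (mem_facesIn.1 (Finset.mem_filter.1 hg).1).2]
        exact Finset.card_le_card fun i hi => mem_faceSupp.2 (Finset.mem_filter.1 hi).2
    _ = (m + 1) * Z.card := by rw [Finset.sum_const, smul_eq_mul, mul_comm]

/-- Coboundary expansion of the cross-polytope on the coordinate set `A`. -/
theorem exists_cobd_expansion (m : ℕ) (A : Finset (Fin n))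
    (β : (Fin n → Option Bool) → ZMod 2) :
    ∃ α : (Fin n → Option Bool) → ZMod 2,
      2 * ((A.card : ℝ) - m) *
          (((facesIn A m).filter fun f => β f + cobd α f ≠ 0).card : ℝ) ≤
        (m + 1) * (((facesIn A (m + 1)).filter fun g => cobd β g ≠ 0).card : ℝ) := by
  induction m generalizing A β with
  | zero =>
    refine ⟨0, ?_⟩
    have hface : ∀ f ∈ facesIn A 0, f = fun _ => none := by
      intro f hf
      funext i
      by_contra h
      have := Finset.card_eq_zero.1 (mem_facesIn.1 hf).2
      have h2 := mem_faceSupp.2 h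
      simp [this] at h2
    by_cases h0 : β (fun _ => none) = 0
    · rw [Finset.filter_false_of_mem]
      · simp
      · intro f hf
        rw [hface f hf]
        simp [h0, cobd]
    have h1 : ((facesIn A 0).filter fun f => β f + cobd 0 f ≠ 0).card ≤ 1 := by
      refine Finset.card_le_one.2 fun f hf g hg => ?_
      rw [hface f (Finset.mem_filter.1 hf).1, hface g (Finset.mem_filter.1 hg).1]
    have h2 : (A ×ˢ (Finset.univ : Finset Bool)).card ≤
        ((facesIn A (0 + 1)).filter fun g => cobd β g ≠ 0).card := by
      have hs : faceSupp (fun _ : Fin n => none) = ∅ := by simp [faceSupp]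
      refine Finset.card_le_card_of_injOn
        (fun x => Function.update (fun _ => none) x.1 (some x.2)) ?_ ?_
      · rintro ⟨i, s⟩ hx
        have hi : i ∈ A := by simpa using hx
        simp only [Finset.coe_filter, Set.mem_ofPred_eq, mem_facesIn, faceSupp_update_some, hs]
        refine ⟨⟨by simpa using hi, by simp⟩, ?_⟩
        rw [cobd_update_some β rfl, hs]
        simpa using h0
      · rintro ⟨i, s⟩ _ ⟨j, t⟩ _ hxy
        have h3 := congrFun hxy i
        by_cases hij : i = j
        · subst hij
          simpa using h3
        · simp [hij] at h3
    rw [Finset.card_product, Finset.card_univ, Fintype.card_bool] at h2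
    have h1' : (((facesIn A 0).filter fun f => β f + cobd 0 f ≠ 0).card : ℝ) ≤ 1 := by
      exact_mod_cast h1
    have h2' : (A.card : ℝ) * 2 ≤
        (((facesIn A (0 + 1)).filter fun g => cobd β g ≠ 0).card : ℝ) := by exact_mod_cast h2
    push_cast
    have := mul_le_mul_of_nonneg_left h1' (by positivity : (0 : ℝ) ≤ 2 * A.card)
    linarith
  | succ k ih =>
    by_cases hA : A.card ≤ k + 1
    · refine ⟨0, le_trans (mul_nonpos_of_nonpos_of_nonneg ?_ (by positivity)) (by positivity)⟩
      have : (A.card : ℝ) ≤ (k + 1 : ℕ) := by exact_mod_cast hA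
      linarith
    push Not at hA
    choose γ hγ using fun i => ih (A.erase i) (linkDiff β i)
    set Dβ := ((facesIn A (k + 1 + 1)).filter fun g => cobd β g ≠ 0).card with hDβ
    let E : Fin n → Bool → ℕ := fun i s => ((facesIn (A.erase i) (k + 1)).filter
      fun f => cobd β (Function.update f i (some s)) ≠ 0).card
    let W : Fin n → Bool → ℕ := fun i s => ((facesIn A (k + 1)).filter
      fun f => β f + cobd (coneCochain β (γ i) i s) f ≠ 0).card
    have hE : ∑ i ∈ A, ∑ s : Bool, (E i s : ℝ) ≤ (k + 2) * Dβ := by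
      have := sum_card_cobd_update_le β A (k + 1)
      have h : ((∑ i ∈ A, ∑ s : Bool, E i s : ℕ) : ℝ) ≤ ((k + 1 + 1) * Dβ : ℕ) := by
        exact_mod_cast this
      push_cast at h
      linarith
    set N : ℝ := (A.card : ℝ) - (k + 1) with hN
    have hN0 : 0 < N := by
      have : ((k + 1 : ℕ) : ℝ) < A.card := by exact_mod_cast hA
      push_cast at this
      linarith
    have hW : ∀ i ∈ A, ∀ s, 2 * N * (W i s : ℝ) ≤
        2 * N * E i s + (k + 1) * ∑ t : Bool, (E i t : ℝ) := by
      intro i hi s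
      set G := ((facesIn (A.erase i) k).filter
        fun g => linkDiff β i g + cobd (γ i) g ≠ 0).card with hG
      have h1 : (W i s : ℝ) ≤ E i s + G := by
        exact_mod_cast card_support_add_cobd_coneCochain_le β (γ i) A k i s
      have h2 := hγ i
      have h3 : (((facesIn (A.erase i) (k + 1)).filter
          fun g => cobd (linkDiff β i) g ≠ 0).card : ℝ) ≤ ∑ t : Bool, (E i t : ℝ) := by
        exact_mod_cast card_cobd_linkDiff_le β A (k + 1) i
      have h4 : ((A.erase i).card : ℝ) - k = N := by
        rw [Finset.card_erase_of_mem hi, Nat.cast_sub (by omega)]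
        push_cast
        ring
      rw [h4] at h2
      have h5 := mul_le_mul_of_nonneg_left h3 (by positivity : (0 : ℝ) ≤ (k : ℝ) + 1)
      have h6 := mul_le_mul_of_nonneg_left h1 (by positivity : (0 : ℝ) ≤ 2 * N)
      linarith
    have hsum : ∑ i ∈ A, ∑ s : Bool, 2 * N * (W i s : ℝ) ≤
        ∑ i ∈ A, ∑ _s : Bool, ((k : ℝ) + 2) * Dβ := by
      calc _ ≤ ∑ i ∈ A, ∑ s : Bool, (2 * N * E i s + (k + 1) * ∑ t : Bool, (E i t : ℝ)) :=
            Finset.sum_le_sum fun i hi => Finset.sum_le_sum fun s _ => hW i hi s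
        _ = 2 * A.card * ∑ i ∈ A, ∑ s : Bool, (E i s : ℝ) := by
            rw [Finset.mul_sum]
            refine Finset.sum_congr rfl fun i _ => ?_
            simp only [Fintype.sum_bool, hN]
            ring
        _ ≤ 2 * A.card * ((k + 2) * Dβ) := by gcongr
        _ = _ := by
            simp only [Finset.sum_const, Finset.card_univ, Fintype.card_bool, nsmul_eq_mul]
            push_cast
            ring
    have hAne : A.Nonempty := Finset.card_pos.1 (by omega)
    obtain ⟨i, _, hi⟩ := Finset.exists_le_of_sum_le hAne hsum
    obtain ⟨s, _, hs⟩ := Finset.exists_le_of_sum_le Finset.univ_nonempty hi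
    refine ⟨coneCochain β (γ i) i s, ?_⟩
    push_cast
    rw [← hN]
    have : ((k : ℝ) + 1 + 1) * Dβ = (k + 2) * Dβ := by ring
    rw [this]
    exact hs

end Faces

section Transfer

variable {n m : ℕ}

/-- Extension by zero of a graded cochain to all sign vectors. -/
noncomputable def extendZero (β : XFace n m → ZMod 2) (f : Fin n → Option Bool) : ZMod 2 :=
  if h : (Finset.univ.filter fun i => f i ≠ none).card = m then β ⟨f, h⟩ else 0

/-- Restriction of an ungraded cochain to the faces with `m` vertices. -/
def restrictFaces (m : ℕ) (F : (Fin n → Option Bool) → ZMod 2) (f : XFace n m) : ZMod 2 :=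
  F f.1

theorem extendZero_apply (β : XFace n m → ZMod 2) (f : XFace n m) : extendZero β f.1 = β f := by
  rw [extendZero, dif_pos f.2]

theorem card_faceSupp (f : XFace n m) : (faceSupp f.1).card = m := f.2

theorem xd_apply_of_restrict (F : (Fin n → Option Bool) → ZMod 2) (β : XFace n m → ZMod 2)
    (hF : ∀ f : XFace n m, β f = F f.1) (g : XFace n (m + 1)) : xd β g = cobd F g.1 := by
  rw [xd, cobd, ← Finset.sum_filter]
  symm
  refine Finset.sum_bij (fun i hi => ⟨Function.update g.1 i none, ?_⟩) ?_ ?_ ?_ ?_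
  · change (faceSupp _).card = m
    rw [faceSupp_update_none, Finset.card_erase_of_mem hi, card_faceSupp g, Nat.add_sub_cancel]
  · intro i hi
    exact Finset.mem_filter.2 ⟨Finset.mem_univ _, i, mem_faceSupp.1 hi, rfl⟩
  · intro i hi j hj h
    by_contra hij
    have := congrFun (congrArg Subtype.val h) i
    simp only [Function.update_self, Function.update_of_ne hij] at this
    exact mem_faceSupp.1 hi this.symm
  · intro f hf
    obtain ⟨-, i, hi, h⟩ := Finset.mem_filter.1 hf
    exact ⟨i, mem_faceSupp.2 hi, Subtype.ext h.symm⟩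
  · intro i hi
    rw [hF]

theorem xd_eq_cobd (β : XFace n m → ZMod 2) (g : XFace n (m + 1)) :
    xd β g = cobd (extendZero β) g.1 :=
  xd_apply_of_restrict _ β (fun f => (extendZero_apply β f).symm) g

theorem cochain_add_self {X : Type} (β : X → ZMod 2) : β + β = 0 :=
  funext fun _ => CharTwo.add_self_eq_zero _

theorem xd_add (β γ : XFace n m → ZMod 2) : xd (β + γ) = xd β + xd γ := by
  funext g
  simp only [xd, Pi.add_apply, ← Finset.sum_add_distrib]
  refine Finset.sum_congr rfl fun f _ => ?_
  split_ifs <;> simp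

theorem cobd_cobd (F : (Fin n → Option Bool) → ZMod 2) (g : Fin n → Option Bool) :
    cobd (cobd F) g = 0 := by
  simp only [cobd, faceSupp_update_none]
  rw [Finset.sum_sigma']
  refine Finset.sum_involution (fun x _ => ⟨x.2, x.1⟩) ?_ ?_ ?_ ?_
  · rintro ⟨i, j⟩ h
    have hij : j ≠ i := (Finset.mem_erase.1 (Finset.mem_sigma.1 h).2).1
    rw [Function.update_comm hij]
    exact CharTwo.add_self_eq_zero _
  · rintro ⟨i, j⟩ h _ heq
    have hij : j ≠ i := (Finset.mem_erase.1 (Finset.mem_sigma.1 h).2).1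
    exact hij (congrArg Sigma.fst heq)
  · rintro ⟨i, j⟩ h
    simp only [Finset.mem_sigma, Finset.mem_erase] at h ⊢
    exact ⟨h.2.2, h.2.1.symm, h.1⟩
  · rintro ⟨i, j⟩ _
    rfl

theorem xd_xd (α : XFace n m → ZMod 2) : xd (xd α) = 0 := by
  funext g
  rw [xd_apply_of_restrict (cobd (extendZero α)) _ (fun f => xd_eq_cobd α f), cobd_cobd]
  rfl

theorem card_filter_facesIn (P : (Fin n → Option Bool) → Prop) [DecidablePred P] :
    ((facesIn Finset.univ m).filter P).card =
      (Finset.univ.filter fun f : XFace n m => P f.1).card := by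
  symm
  refine Finset.card_bij (fun f _ => f.1) ?_ ?_ ?_
  · intro f hf
    exact Finset.mem_filter.2 ⟨mem_facesIn.2 ⟨Finset.subset_univ _, card_faceSupp f⟩,
      (Finset.mem_filter.1 hf).2⟩
  · intro f _ g _ h
    exact Subtype.ext h
  · intro f hf
    obtain ⟨hf, hP⟩ := Finset.mem_filter.1 hf
    exact ⟨⟨f, (mem_facesIn.1 hf).2⟩, Finset.mem_filter.2 ⟨Finset.mem_univ _, hP⟩, rfl⟩

theorem xqnorm_le (β : XFace n (m + 1) → ZMod 2) (α : XFace n m → ZMod 2) :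
    xqnorm β ≤ cnorm (β + xd α) :=
  Nat.sInf_le ⟨α, rfl⟩

theorem exists_cnorm_eq_xqnorm (β : XFace n (m + 1) → ZMod 2) :
    ∃ α : XFace n m → ZMod 2, xqnorm β = cnorm (β + xd α) :=
  Nat.sInf_mem (s := {j | ∃ α : XFace n m → ZMod 2, j = cnorm (β + xd α)}) ⟨_, 0, rfl⟩

/-- Coboundary expansion of the cross-polytope. -/
theorem xqnorm_expansion (hn : m + 1 ≤ n) (β : XFace n (m + 1) → ZMod 2) :
    2 * ((n : ℝ) - m - 1) * xqnorm β ≤ (m + 2) * cnorm (xd β) := by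
  obtain ⟨α, hα⟩ := exists_cobd_expansion (m + 1) Finset.univ (extendZero β)
  rw [card_filter_facesIn, card_filter_facesIn] at hα
  have h1 : (Finset.univ.filter
      fun f : XFace n (m + 1) => extendZero β f.1 + cobd α f.1 ≠ 0).card =
      cnorm (β + xd (restrictFaces m α)) := by
    rw [cnorm]
    congr 1
    refine Finset.filter_congr fun f _ => ?_
    rw [extendZero_apply, Pi.add_apply, xd_apply_of_restrict α (restrictFaces m α) fun f => rfl]
  have h2 : (Finset.univ.filter
      fun g : XFace n (m + 1 + 1) => cobd (extendZero β) g.1 ≠ 0).card = cnorm (xd β) := by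
    rw [cnorm]
    congr 1
    exact Finset.filter_congr fun g _ => by rw [xd_eq_cobd]
  rw [h1, h2, Finset.card_univ, Fintype.card_fin] at hα
  push_cast at hα
  have h3 : (xqnorm β : ℝ) ≤ cnorm (β + xd (restrictFaces m α)) := by
    exact_mod_cast xqnorm_le β _
  have h4 : (0 : ℝ) ≤ 2 * ((n : ℝ) - m - 1) := by
    have : ((m + 1 : ℕ) : ℝ) ≤ n := by exact_mod_cast hn
    push_cast at this
    linarith
  calc _ ≤ 2 * ((n : ℝ) - m - 1) * cnorm (β + xd (restrictFaces m α)) := by gcongr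
    _ = 2 * ((n : ℝ) - (m + 1)) * cnorm (β + xd (restrictFaces m α)) := by ring
    _ ≤ _ := hα
    _ = _ := by ring

/-- A non-coboundary has a nonzero representative of minimal norm. -/
theorem exists_minimal_representative {β : XFace n (m + 1) → ZMod 2} (hβ : ¬ IsXCob β) :
    ∃ γ : XFace n (m + 1) → ZMod 2, γ ≠ 0 ∧ xd γ = xd β ∧ cnorm γ = xqnorm β ∧
      xqnorm γ = xqnorm β := by
  obtain ⟨α, hα⟩ := exists_cnorm_eq_xqnorm β
  refine ⟨β + xd α, fun h => hβ ⟨α, ?_⟩, ?_, hα.symm, ?_⟩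
  · exact funext fun f => (CharTwo.add_eq_zero.1 (congrFun h f)).symm
  · rw [xd_add, xd_xd, add_zero]
  · have hset : ∀ δ : XFace n m → ZMod 2, β + xd α + xd (α + δ) = β + xd δ := by
      intro δ
      rw [xd_add, add_assoc, ← add_assoc (xd α), cochain_add_self, zero_add]
    obtain ⟨δ, hδ⟩ := exists_cnorm_eq_xqnorm (β + xd α)
    apply le_antisymm
    · exact (xqnorm_le _ (α + α)).trans_eq (by rw [hset, hα])
    · have := xqnorm_le β (α + δ)
      rw [xd_add, ← add_assoc, ← hδ] at this
      exact this

theorem card_xFace_le (n m : ℕ) : Fintype.card (XFace n m) ≤ (2 * n) ^ m := by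
  have h : Fintype.card (XFace n m) = (facesIn (Finset.univ : Finset (Fin n)) m).card := by
    have := card_filter_facesIn (n := n) (m := m) (fun _ => True)
    rw [Finset.filter_true, Finset.filter_true, Finset.card_univ] at this
    exact this.symm
  rw [h]
  clear h
  induction m with
  | zero =>
    rw [pow_zero]
    refine Finset.card_le_one.2 fun f hf g hg => funext fun i => ?_
    have hf := Finset.card_eq_zero.1 (mem_facesIn.1 hf).2
    have hg := Finset.card_eq_zero.1 (mem_facesIn.1 hg).2
    have h1 : ¬ i ∈ faceSupp f := by simp [hf]
    have h2 : ¬ i ∈ faceSupp g := by simp [hg]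
    rw [mem_faceSupp, not_not] at h1 h2
    rw [h1, h2]
  | succ m ih =>
    calc _ ≤ (((facesIn (Finset.univ : Finset (Fin n)) m) ×ˢ
            (Finset.univ : Finset (Fin n × Bool))).image
              fun x : (Fin n → Option Bool) × Fin n × Bool =>
                Function.update x.1 x.2.1 (some x.2.2)).card := by
          refine Finset.card_le_card fun f hf => ?_
          obtain ⟨-, hc⟩ := mem_facesIn.1 hf
          obtain ⟨i, hi⟩ := Finset.card_pos.1 (by omega : 0 < (faceSupp f).card)
          obtain ⟨s, hs⟩ := Option.ne_none_iff_exists'.1 (mem_faceSupp.1 hi)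
          refine Finset.mem_image.2 ⟨(Function.update f i none, i, s), ?_, ?_⟩
          · rw [Finset.mem_product]
            refine ⟨mem_facesIn.2 ⟨Finset.subset_univ _, ?_⟩, Finset.mem_univ _⟩
            rw [faceSupp_update_none, Finset.card_erase_of_mem hi, hc, Nat.add_sub_cancel]
          · simp only [Function.update_idem]
            rw [← hs, Function.update_eq_self]
      _ ≤ _ := Finset.card_image_le
      _ = (facesIn (Finset.univ : Finset (Fin n)) m).card * (2 * n) := by
          rw [Finset.card_product, Finset.card_univ, Fintype.card_prod, Fintype.card_fin,
            Fintype.card_bool, mul_comm n]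
      _ ≤ _ := by
          rw [pow_succ]
          gcongr

end Transfer

section Probability

theorem exp_neg_le_quadratic {x : ℝ} (hx : 0 ≤ x) : Real.exp (-x) ≤ 1 - x + x ^ 2 / 2 := by
  have h := Real.quadratic_le_exp_of_nonneg hx
  have hpos : (0 : ℝ) < 1 + x + x ^ 2 / 2 := by positivity
  rw [Real.exp_neg]
  refine (inv_anti₀ hpos h).trans ?_
  rw [inv_le_iff_one_le_mul₀' hpos]
  nlinarith [sq_nonneg (x ^ 2)]

/-- The moment generating function of the size of a Bernoulli random subset of `Y`
intersected with `S`. -/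
theorem sum_bernoulli_pow_inter {Y : Type*} [Fintype Y] [DecidableEq Y] (p c : ℝ) (S : Finset Y) :
    ∑ V : Finset Y, p ^ V.card * (1 - p) ^ (Fintype.card Y - V.card) *
      c ^ (V.filter fun y => y ∈ S).card = (1 - p + p * c) ^ S.card := by
  have h := Finset.prod_add (fun y : Y => p * if y ∈ S then c else 1) (fun _ => 1 - p)
    Finset.univ
  rw [Finset.powerset_univ] at h
  calc _ = ∑ V : Finset Y, (∏ y ∈ V, (p * if y ∈ S then c else 1)) *
        ∏ _y ∈ Finset.univ \ V, (1 - p) := by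
        refine Finset.sum_congr rfl fun V _ => ?_
        rw [Finset.prod_mul_distrib, Finset.prod_const, Finset.prod_const, ← Finset.prod_filter,
          Finset.prod_const, Finset.card_univ_sdiff]
        ring
    _ = ∏ y : Y, ((p * if y ∈ S then c else 1) + (1 - p)) := h.symm
    _ = ∏ y : Y, if y ∈ S then 1 - p + p * c else 1 := by
        refine Finset.prod_congr rfl fun y _ => ?_
        split_ifs <;> ring
    _ = _ := by simp [Finset.prod_ite_mem]

theorem sum_bernoulli_weight {Y : Type*} [Fintype Y] (p : ℝ) :
    ∑ V : Finset Y, p ^ V.card * (1 - p) ^ (Fintype.card Y - V.card) = 1 := by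
  simpa using sum_bernoulli_pow_inter p 1 (∅ : Finset Y)

/-- Chernoff bound for the lower tail, in exponential moment form. -/
theorem sum_bernoulli_exp_le {Y : Type*} [Fintype Y] [DecidableEq Y] {p ε : ℝ} (hp0 : 0 ≤ p)
    (hp1 : p ≤ 1) (hε0 : 0 ≤ ε) (S : Finset Y) :
    ∑ V : Finset Y, p ^ V.card * (1 - p) ^ (Fintype.card Y - V.card) *
      Real.exp (ε * ((1 - ε) * p * S.card - (V.filter fun y => y ∈ S).card)) ≤
      Real.exp (-(ε ^ 2 * p * S.card / 2)) := by
  have h : ∀ V : Finset Y,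
      Real.exp (ε * ((1 - ε) * p * S.card - (V.filter fun y => y ∈ S).card)) =
      Real.exp (ε * ((1 - ε) * p * S.card)) *
        Real.exp (-ε) ^ (V.filter fun y => y ∈ S).card := by
    intro V
    rw [← Real.exp_nat_mul, ← Real.exp_add]
    congr 1
    ring
  calc _ = Real.exp (ε * ((1 - ε) * p * S.card)) * (1 - p + p * Real.exp (-ε)) ^ S.card := by
        rw [← sum_bernoulli_pow_inter, Finset.mul_sum]
        refine Finset.sum_congr rfl fun V _ => ?_
        rw [h]
        ring
    _ ≤ Real.exp (ε * ((1 - ε) * p * S.card)) *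
        Real.exp (-p * (ε - ε ^ 2 / 2)) ^ S.card := by
        have h1 : 1 - p + p * Real.exp (-ε) ≤ Real.exp (-p * (ε - ε ^ 2 / 2)) := by
          have h2 := mul_le_mul_of_nonneg_left (exp_neg_le_quadratic hε0) hp0
          have h3 := Real.add_one_le_exp (-p * (ε - ε ^ 2 / 2))
          linarith
        have h4 : 0 ≤ 1 - p + p * Real.exp (-ε) :=
          add_nonneg (sub_nonneg.2 hp1) (mul_nonneg hp0 (Real.exp_nonneg _))
        gcongr
    _ = _ := by
        rw [← Real.exp_nat_mul, ← Real.exp_add]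
        congr 1
        ring

theorem sum_pow_cnorm {X : Type} [Fintype X] [DecidableEq X] (q : ℝ) :
    ∑ β : X → ZMod 2, q ^ cnorm β = (1 + q) ^ Fintype.card X := by
  have h := Finset.prod_univ_sum (fun _ : X => (Finset.univ : Finset (ZMod 2)))
    (fun _ a => if a ≠ 0 then q else (1 : ℝ))
  rw [Fintype.piFinset_univ] at h
  have h2 : ∑ a : ZMod 2, (if a ≠ 0 then q else (1 : ℝ)) = 1 + q := by
    rw [show (Finset.univ : Finset (ZMod 2)) = {0, 1} from rfl]
    simp
  calc _ = ∑ β : X → ZMod 2, ∏ x, (if β x ≠ 0 then q else (1 : ℝ)) := by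
        refine Finset.sum_congr rfl fun β _ => ?_
        rw [← Finset.prod_filter, Finset.prod_const, cnorm]
    _ = ∏ _x : X, (1 + q) := by rw [← h, h2]
    _ = _ := by rw [Finset.prod_const, Finset.card_univ]

theorem sum_pow_cnorm_ne_zero_le {X : Type} [Fintype X] [DecidableEq X] {q : ℝ} (hq : 0 ≤ q) :
    ∑ β ∈ Finset.univ.filter (fun β : X → ZMod 2 => β ≠ 0), q ^ cnorm β ≤
      Real.exp (Fintype.card X * q) - 1 := by
  have h0 : cnorm (0 : X → ZMod 2) = 0 := by simp [cnorm]
  have h1 := Finset.add_sum_erase Finset.univ (fun β : X → ZMod 2 => q ^ cnorm β)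
    (Finset.mem_univ 0)
  rw [sum_pow_cnorm, h0, pow_zero, ← Finset.filter_ne'] at h1
  have h2 : (1 + q) ^ Fintype.card X ≤ Real.exp (Fintype.card X * q) := by
    rw [Real.exp_nat_mul]
    gcongr
    linarith [Real.add_one_le_exp q]
  linarith

/-- The event that the random subcomplex `V` has expansion at least `T`. -/
def HasExpansion {n k : ℕ} (T : ℝ) (V : Finset (XFace n (k + 2))) : Prop :=
  ∀ β : XFace n (k + 1) → ZMod 2, ¬ IsXCob β →
    ((V.filter fun g => xd β g ≠ 0).card : ℝ) ≥ T * (xqnorm β : ℝ)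

theorem sum_ite_zero_add_sum_ite_zero {Y : Type*} [Fintype Y] (P : Y → Prop) (w : Y → ℝ) :
    ∑ y, (if P y then w y else 0) + ∑ y, (if P y then 0 else w y) = ∑ y, w y := by
  rw [← Finset.sum_add_distrib]
  refine Finset.sum_congr rfl fun y _ => ?_
  split_ifs <;> simp

theorem sum_not_hasExpansion_le {n k : ℕ} (hn : k + 1 < n) {ε p : ℝ} (hε0 : 0 < ε)
    (hε1 : ε < 1) (hp0 : 0 ≤ p) (hp1 : p ≤ 1) :
    ∑ V : Finset (XFace n (k + 2)),
      (if HasExpansion (2 * (1 - ε) * ((n : ℝ) - k - 1) * p / (k + 2)) V then 0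
        else p ^ V.card * (1 - p) ^ (Fintype.card (XFace n (k + 2)) - V.card)) ≤
      Real.exp (Fintype.card (XFace n (k + 1)) *
        Real.exp (-(ε ^ 2 * p * ((n : ℝ) - k - 1) / (k + 2)))) - 1 := by
  set q := Real.exp (-(ε ^ 2 * p * ((n : ℝ) - k - 1) / (k + 2))) with hq
  set w : Finset (XFace n (k + 2)) → ℝ :=
    fun V => p ^ V.card * (1 - p) ^ (Fintype.card (XFace n (k + 2)) - V.card) with hw
  set M := Finset.univ.filter
    (fun γ : XFace n (k + 1) → ZMod 2 => γ ≠ 0 ∧ cnorm γ = xqnorm γ) with hM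
  have hw0 : ∀ V, 0 ≤ w V := fun V => mul_nonneg (pow_nonneg hp0 _)
    (pow_nonneg (sub_nonneg.2 hp1) _)
  have hk2 : (0 : ℝ) < k + 2 := by positivity
  let S : (XFace n (k + 1) → ZMod 2) → Finset (XFace n (k + 2)) :=
    fun γ => Finset.univ.filter fun g => xd γ g ≠ 0
  let e : (XFace n (k + 1) → ZMod 2) → Finset (XFace n (k + 2)) → ℝ := fun γ V =>
    Real.exp (ε * ((1 - ε) * p * (S γ).card - (V.filter fun g => g ∈ S γ).card))
  have hS : ∀ γ ∈ M, 2 * ((n : ℝ) - k - 1) / (k + 2) * cnorm γ ≤ (S γ).card := by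
    intro γ hγ
    rw [(Finset.mem_filter.1 hγ).2.2, div_mul_eq_mul_div, div_le_iff₀ hk2, mul_comm _ ((k : ℝ) + 2)]
    exact xqnorm_expansion hn.le γ
  have hbad : ∀ V, ¬ HasExpansion (2 * (1 - ε) * ((n : ℝ) - k - 1) * p / (k + 2)) V →
      1 ≤ ∑ γ ∈ M, e γ V := by
    intro V hV
    rw [HasExpansion] at hV
    push Not at hV
    obtain ⟨β, hβ, hlt⟩ := hV
    obtain ⟨γ, hγ0, hγd, hγn, hγq⟩ := exists_minimal_representative hβ
    have hγM : γ ∈ M := Finset.mem_filter.2 ⟨Finset.mem_univ _, hγ0, hγn.trans hγq.symm⟩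
    refine le_trans ?_ (Finset.single_le_sum (f := fun γ => e γ V)
      (fun γ _ => Real.exp_nonneg _) hγM)
    refine Real.one_le_exp (mul_nonneg hε0.le (sub_nonneg.2 ?_))
    have h1 := mul_le_mul_of_nonneg_left (hS γ hγM)
      (mul_nonneg (sub_nonneg.2 hε1.le) hp0)
    have h2 : (V.filter fun g => g ∈ S γ) = V.filter fun g => xd β g ≠ 0 := by
      refine Finset.filter_congr fun g _ => ?_
      simp [S, hγd]
    rw [h2]
    refine hlt.le.trans (le_trans (le_of_eq ?_) h1)
    rw [hγn]
    ring
  calc _ ≤ ∑ V, w V * ∑ γ ∈ M, e γ V := by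
        refine Finset.sum_le_sum fun V _ => ?_
        split_ifs with h
        · exact mul_nonneg (hw0 V) (Finset.sum_nonneg fun γ _ => Real.exp_nonneg _)
        · exact le_mul_of_one_le_right (hw0 V) (hbad V h)
    _ = ∑ γ ∈ M, ∑ V, w V * e γ V := by
        simp only [Finset.mul_sum]
        exact Finset.sum_comm
    _ ≤ ∑ γ ∈ M, q ^ cnorm γ := by
        refine Finset.sum_le_sum fun γ hγ =>
          (sum_bernoulli_exp_le hp0 hp1 hε0.le (S γ)).trans ?_
        rw [hq, ← Real.exp_nat_mul]
        refine Real.exp_le_exp.2 ?_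
        have := mul_le_mul_of_nonneg_left (hS γ hγ)
          (by positivity : (0 : ℝ) ≤ ε ^ 2 * p / 2)
        have h3 : ε ^ 2 * p / 2 * (2 * ((n : ℝ) - k - 1) / (k + 2) * cnorm γ) =
          cnorm γ * (ε ^ 2 * p * ((n : ℝ) - k - 1) / (k + 2)) := by ring
        linarith
    _ ≤ ∑ γ ∈ Finset.univ.filter (fun γ : XFace n (k + 1) → ZMod 2 => γ ≠ 0),
          q ^ cnorm γ := by
        refine Finset.sum_le_sum_of_subset_of_nonneg (fun γ hγ => ?_)
          fun γ _ _ => pow_nonneg (Real.exp_nonneg _) _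
        exact Finset.mem_filter.2 ⟨Finset.mem_univ _, (Finset.mem_filter.1 hγ).2.1⟩
    _ ≤ _ := sum_pow_cnorm_ne_zero_le (Real.exp_nonneg _)

theorem card_xFace_mul_exp_le {n k : ℕ} (hn : k + 1 < n) {ε p ω : ℝ} (hε0 : 0 < ε)
    (hp : p ≥ (((k : ℝ) + 2) * ((k : ℝ) + 1) * Real.log n + ω) /
        (ε ^ 2 * ((n : ℝ) - (k : ℝ) - 1))) :
    Fintype.card (XFace n (k + 1)) * Real.exp (-(ε ^ 2 * p * ((n : ℝ) - k - 1) / (k + 2))) ≤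
      2 ^ (k + 1) * Real.exp (-(ω / (k + 2))) := by
  have hk2 : (0 : ℝ) < k + 2 := by positivity
  have hn0 : (0 : ℝ) < n := by
    have : 0 < n := by omega
    exact_mod_cast this
  have hN : (0 : ℝ) < (n : ℝ) - k - 1 := by
    have : ((k + 1 : ℕ) : ℝ) < n := by exact_mod_cast hn
    push_cast at this
    linarith
  have hexp : Real.exp (-(ε ^ 2 * p * ((n : ℝ) - k - 1) / (k + 2))) ≤
      ((n : ℝ) ^ (k + 1))⁻¹ * Real.exp (-(ω / (k + 2))) := by
    have hpow : ((n : ℝ) ^ (k + 1))⁻¹ = Real.exp (-((k + 1) * Real.log n)) := by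
      rw [Real.exp_neg, ← Nat.cast_succ, Real.exp_nat_mul, Real.exp_log hn0]
    rw [hpow, ← Real.exp_add]
    refine Real.exp_le_exp.2 ?_
    rw [ge_iff_le, div_le_iff₀ (by positivity)] at hp
    rw [← neg_add, neg_le_neg_iff, le_div_iff₀ hk2, add_mul, div_mul_cancel₀ _ hk2.ne']
    linarith
  have hcard : (Fintype.card (XFace n (k + 1)) : ℝ) ≤ 2 ^ (k + 1) * (n : ℝ) ^ (k + 1) := by
    rw [← mul_pow]
    exact_mod_cast card_xFace_le n (k + 1)
  calc _ ≤ 2 ^ (k + 1) * (n : ℝ) ^ (k + 1) *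
        (((n : ℝ) ^ (k + 1))⁻¹ * Real.exp (-(ω / (k + 2)))) := by gcongr
    _ = _ := by field_simp

end Probability

/-- expansion of a random subcomplex of the `n`-dimensional
cross-polytope. Fix `k ≥ 1`, `0 < ε < 1`, `ω → ∞`, and
`p(n) ≥ ((k+2)(k+1)·log n + ω(n))/(ε²(n-k-1))` for `n > k+1`. Then the
probability (a weighted sum over all sets `V` of `(k+1)`-faces, each face kept
independently with probability `p(n)`) of the event that every non-coboundary
`k`-cochain `β` satisfies `‖dβ‖_V ≥ (2(1-ε)(n-k-1)p(n)/(k+2))·‖[β]‖` — i.e.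
that `h^k(V) ≥ 2(1-ε)(n-k-1)p(n)/(k+2)` — tends to `1` as `n → ∞`. -/
theorem cross_polytope_random_expansion (k : ℕ) (hk : 1 ≤ k) (ε : ℝ) (hε0 : 0 < ε) (hε1 : ε < 1)
    (ω : ℕ → ℝ) (hω : Filter.Tendsto ω Filter.atTop Filter.atTop)
    (p : ℕ → ℝ) (hp0 : ∀ n, 0 ≤ p n) (hp1 : ∀ n, p n ≤ 1)
    (hp : ∀ n : ℕ, k + 1 < n →
      p n ≥ (((k : ℝ) + 2) * ((k : ℝ) + 1) * Real.log n + ω n) /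
        (ε ^ 2 * ((n : ℝ) - (k : ℝ) - 1))) :
    Filter.Tendsto
      (fun n : ℕ => ∑ V : Finset (XFace n (k + 2)),
        if ∀ β : XFace n (k + 1) → ZMod 2, ¬ IsXCob β →
            ((V.filter fun g => xd β g ≠ 0).card : ℝ) ≥
              2 * (1 - ε) * ((n : ℝ) - (k : ℝ) - 1) * p n / ((k : ℝ) + 2) * (xqnorm β : ℝ)
          then p n ^ V.card * (1 - p n) ^ (Fintype.card (XFace n (k + 2)) - V.card) else 0)
      Filter.atTop (nhds 1) := by
  suffices h : Filter.Tendsto (fun n : ℕ => ∑ V : Finset (XFace n (k + 2)),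
      if HasExpansion (2 * (1 - ε) * ((n : ℝ) - k - 1) * p n / (k + 2)) V then
        p n ^ V.card * (1 - p n) ^ (Fintype.card (XFace n (k + 2)) - V.card) else 0)
      Filter.atTop (nhds 1) by
    refine h.congr fun n => Finset.sum_congr rfl fun V _ => ?_
    by_cases hV : HasExpansion (2 * (1 - ε) * ((n : ℝ) - k - 1) * p n / (k + 2)) V
    · rw [if_pos hV]
      exact (if_pos hV).symm
    · rw [if_neg hV]
      exact (if_neg hV).symm
  have hk2 : (0 : ℝ) < k + 2 := by positivity
  have hlim : Filter.Tendsto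
      (fun n => 2 - Real.exp (2 ^ (k + 1) * Real.exp (-(ω n / (k + 2))))) Filter.atTop
      (nhds 1) := by
    have h1 : Filter.Tendsto (fun n => Real.exp (-(ω n / ((k : ℝ) + 2)))) Filter.atTop (nhds 0) :=
      Real.tendsto_exp_neg_atTop_nhds_zero.comp (hω.atTop_div_const hk2)
    have h2 := ((Real.continuous_exp.tendsto _).comp (h1.const_mul (2 ^ (k + 1)))).const_sub 2
    have h3 : (2 : ℝ) - Real.exp (2 ^ (k + 1) * 0) = 1 := by norm_num
    rwa [h3] at h2
  have hweight : ∀ n (V : Finset (XFace n (k + 2))),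
      0 ≤ p n ^ V.card * (1 - p n) ^ (Fintype.card (XFace n (k + 2)) - V.card) := fun n V =>
    mul_nonneg (pow_nonneg (hp0 n) _) (pow_nonneg (sub_nonneg.2 (hp1 n)) _)
  refine tendsto_of_tendsto_of_tendsto_of_le_of_le' hlim tendsto_const_nhds ?_
    (Filter.Eventually.of_forall fun n => ?_)
  · filter_upwards [Filter.eventually_gt_atTop (k + 1)] with n hn
    have hbad := sum_not_hasExpansion_le hn hε0 hε1 (hp0 n) (hp1 n)
    have hexp := Real.exp_le_exp.2 (card_xFace_mul_exp_le hn hε0 (hp n hn))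
    have htotal := sum_bernoulli_weight (Y := XFace n (k + 2)) (p n)
    rw [← sum_ite_zero_add_sum_ite_zero
      (HasExpansion (2 * (1 - ε) * ((n : ℝ) - k - 1) * p n / (k + 2)))] at htotal
    linarith
  · refine le_trans (Finset.sum_le_sum fun V _ => ?_)
      (sum_bernoulli_weight (Y := XFace n (k + 2)) (p n)).le
    split_ifs
    · exact le_rfl
    · exact hweight n V
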